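/- For 0 < β < 1 and real numbers a < b, c < d, one has C_β ∫_{-∞}^{∞} F1_{[a,b]}(ξ) · conj(F1_{[c,d]}(ξ)) |ξ|^{β-1} dξ = (2π / ((2-β)(1-β))) ( |c-b|^{2-β} + |d-a|^{2-β} - |c-a|^{2-β} - |d-b|^{2-β} ). -/

import Mathlib

open MeasureTheory Real

/-- The Fourier transform of the indicator of `[a, b]`. -/
noncomputable def fourierInd (a b ξ : ℝ) : ℂ :=
  (Complex.exp (-Complex.I * ξ * a) - Complex.exp (-Complex.I * ξ * b)) / (Complex.I * ξ)

lemma tonelli_aux {μ ν : Measure ℝ} [SFinite μ] [SFinite ν] (f : ℝ → ℝ → ℝ)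
    (hm : Measurable (Function.uncurry f)) (h0 : ∀ᵐ y ∂ν, ∀ᵐ x ∂μ, 0 ≤ f x y)
    (hi : ∀ᵐ y ∂ν, Integrable (fun x => f x y) μ)
    (hB : Integrable (fun y => ∫ x, f x y ∂μ) ν) :
    Integrable (fun x => ∫ y, f x y ∂ν) μ ∧
      ∫ x, ∫ y, f x y ∂ν ∂μ = ∫ y, ∫ x, f x y ∂μ ∂ν := by
  have hint : Integrable (Function.uncurry f) (μ.prod ν) := by
    rw [integrable_prod_iff' hm.aestronglyMeasurable]
    refine ⟨hi, hB.congr ?_⟩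
    filter_upwards [h0] with y hy
    apply integral_congr_ae
    filter_upwards [hy] with x hx
    simp [abs_of_nonneg hx]
  exact ⟨hint.integral_prod_left, integral_integral_swap hint⟩

lemma gint {p r : ℝ} (hp0 : 0 < p) (hr : 0 < r) :
    IntegrableOn (fun t : ℝ => t ^ (p - 1) * rexp (-(r * t))) (Set.Ioi 0) := by
  have h := integrableOn_rpow_mul_exp_neg_mul_rpow (p := 1) (s := p - 1) (b := r)
    (by linarith) one_pos hr
  simpa using h

/-- `∫ v^{p-2} (1 - e^{-rv}) dv` over `(0,∞)`. -/
lemma stepA {p r : ℝ} (hp0 : 0 < p) (hp1 : p < 1) (hr : 0 < r) :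
    IntegrableOn (fun v : ℝ => v ^ (p - 2) * (1 - rexp (-(r * v)))) (Set.Ioi 0) ∧
    ∫ v in Set.Ioi (0:ℝ), v ^ (p - 2) * (1 - rexp (-(r * v)))
      = r ^ (1 - p) / (1 - p) * Gamma p := by
  have key := tonelli_aux (μ := volume.restrict (Set.Ioi (0:ℝ)))
    (ν := volume.restrict (Set.Ioc (0:ℝ) r)) (fun v w => v ^ (p - 1) * rexp (-(w * v)))
    (by unfold Function.uncurry; fun_prop) ?_ ?_ ?_
  · have e1 : ∀ v ∈ Set.Ioi (0:ℝ), (∫ w in Set.Ioc (0:ℝ) r, v ^ (p - 1) * rexp (-(w * v)))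
        = v ^ (p - 2) * (1 - rexp (-(r * v))) := by
      intro v hv
      have hv : 0 < v := hv
      rw [← intervalIntegral.integral_of_le hr.le, intervalIntegral.integral_const_mul]
      have : ∫ w in (0:ℝ)..r, rexp (-(w * v)) = (1 - rexp (-(r * v))) / v := by
        have := intervalIntegral.integral_eq_sub_of_hasDerivAt (a := 0) (b := r)
          (f := fun w => - rexp (-(w * v)) / v) (f' := fun w => rexp (-(w * v))) ?_ ?_
        · rw [this]; simp; ring
        · intro w _
          have h := (((hasDerivAt_id w).mul_const v).neg.exp.neg.div_const v)
          refine HasDerivAt.congr_deriv (f := fun w => - rexp (-(w * v)) / v) h ?_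
          simp only [id, Pi.neg_apply, Pi.mul_apply]
          field_simp
        · apply Continuous.intervalIntegrable; fun_prop
      rw [this, show p - 2 = (p - 1) - 1 by ring, rpow_sub_one hv.ne' (p - 1)]
      ring
    have e2 : ∀ w ∈ Set.Ioc (0:ℝ) r, (∫ v in Set.Ioi (0:ℝ), v ^ (p - 1) * rexp (-(w * v)))
        = w ^ (-p) * Gamma p := by
      intro w hw
      rw [integral_rpow_mul_exp_neg_mul_Ioi hp0 hw.1, one_div, inv_rpow hw.1.le, rpow_neg hw.1.le]
    obtain ⟨k1, k2⟩ := key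
    refine ⟨IntegrableOn.congr_fun k1 e1 measurableSet_Ioi, ?_⟩
    rw [← setIntegral_congr_fun measurableSet_Ioi e1, k2,
      setIntegral_congr_fun measurableSet_Ioc e2, integral_mul_const,
      ← intervalIntegral.integral_of_le hr.le, integral_rpow (by left; linarith),
      zero_rpow (by linarith), show -p + 1 = 1 - p by ring]
    ring
  · refine Filter.Eventually.of_forall fun w => ?_
    filter_upwards [ae_restrict_mem measurableSet_Ioi] with v hv
    have hv : 0 < v := hv
    positivity
  · filter_upwards [ae_restrict_mem measurableSet_Ioc] with w hw
    exact gint hp0 hw.1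
  · have h := (intervalIntegral.intervalIntegrable_rpow' (a := 0) (b := r) (r := -p)
      (by linarith)).mul_const (Gamma p)
    rw [intervalIntegrable_iff_integrableOn_Ioc_of_le hr.le] at h
    refine IntegrableOn.congr_fun h ?_ measurableSet_Ioc
    intro w hw
    simp only
    rw [integral_rpow_mul_exp_neg_mul_Ioi hp0 hw.1, one_div, inv_rpow hw.1.le, rpow_neg hw.1.le]

lemma stepB {p r : ℝ} (hp0 : 0 < p) (hp1 : p < 1) (hr : 0 < r) :
    IntegrableOn (fun u : ℝ => u ^ (-p) * (1 - rexp (-(r * u⁻¹)))) (Set.Ioi 0) ∧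
    ∫ u in Set.Ioi (0:ℝ), u ^ (-p) * (1 - rexp (-(r * u⁻¹)))
      = r ^ (1 - p) / (1 - p) * Gamma p := by
  obtain ⟨h1, h2⟩ := stepA hp0 hp1 hr
  rw [← integrableOn_Ioi_comp_rpow_iff _ (p := -1) (by norm_num)] at h1
  rw [← integral_comp_rpow_Ioi _ (p := -1) (by norm_num)] at h2
  have e : ∀ u ∈ Set.Ioi (0:ℝ), (|(-1:ℝ)| * u ^ ((-1:ℝ) - 1)) •
      ((u ^ (-1:ℝ)) ^ (p - 2) * (1 - rexp (-(r * u ^ (-1:ℝ)))))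
      = u ^ (-p) * (1 - rexp (-(r * u⁻¹))) := by
    intro u hu
    have hu : 0 < u := hu
    rw [← rpow_mul hu.le, rpow_neg_one, smul_eq_mul, abs_neg, abs_one, one_mul, ← mul_assoc,
      ← rpow_add hu]
    ring_nf
  exact ⟨h1.congr_fun e measurableSet_Ioi, by
    rw [← h2]; exact (setIntegral_congr_fun measurableSet_Ioi e).symm⟩

lemma gauss {u : ℝ} (hu : 0 < u) :
    Integrable (fun t : ℝ => (1 - cos t) * rexp (-(t ^ 2 * u))) ∧
    ∫ t : ℝ, (1 - cos t) * rexp (-(t ^ 2 * u)) = √(π / u) * (1 - rexp (-((1/4) * u⁻¹))) := by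
  have i1 : Integrable (fun t : ℝ => rexp (-u * t ^ 2)) := integrable_exp_neg_mul_sq hu
  have i2 : Integrable (fun t : ℝ => cos t * rexp (-u * t ^ 2)) := by
    refine i1.bdd_mul (c := 1) (by fun_prop) ?_
    exact Filter.Eventually.of_forall fun t => by simpa using abs_cos_le_one t
  have e : ∀ t : ℝ, (1 - cos t) * rexp (-(t ^ 2 * u))
      = rexp (-u * t ^ 2) - cos t * rexp (-u * t ^ 2) := by
    intro t
    rw [show -(t ^ 2 * u) = -u * t ^ 2 by ring]; ring
  have h3 : ∫ t : ℝ, cos t * rexp (-u * t ^ 2) = √(π / u) * rexp (-((1/4) * u⁻¹)) := by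
    have hF := fourierIntegral_gaussian (b := (u:ℂ)) (by simpa using hu) 1
    have hne : ∫ x : ℝ, Complex.exp (Complex.I * 1 * ↑x) * Complex.exp (-(u:ℂ) * ↑x ^ 2) ≠ 0 := by
      rw [hF]
      refine mul_ne_zero ?_ (Complex.exp_ne_zero _)
      rw [Ne, Complex.cpow_eq_zero_iff]
      simp [pi_ne_zero, hu.ne']
    have hI := Integrable.of_integral_ne_zero hne
    have h := integral_re hI
    simp only [RCLike.re_to_complex] at h
    rw [hF] at h
    have a1 : ∀ x : ℝ, (Complex.exp (Complex.I * 1 * ↑x) * Complex.exp (-(u:ℂ) * ↑x ^ 2)).re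
        = cos x * rexp (-u * x ^ 2) := by
      intro x
      rw [show -(u:ℂ) * (x:ℂ) ^ 2 = ((-u * x ^ 2 : ℝ) : ℂ) by push_cast; ring,
        ← Complex.ofReal_exp, Complex.re_mul_ofReal,
        show Complex.I * 1 * (x:ℂ) = (x:ℂ) * Complex.I by ring, Complex.exp_ofReal_mul_I_re]
    have a2 : ((π:ℂ) / u) ^ (1 / 2 : ℂ) * Complex.exp (-1 ^ 2 / (4 * (u:ℂ)))
        = ((√(π / u) * rexp (-((1/4) * u⁻¹)) : ℝ) : ℂ) := by
      rw [sqrt_eq_rpow, Complex.ofReal_mul, Complex.ofReal_cpow (by positivity),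
        Complex.ofReal_exp]
      push_cast
      congr 2
      field_simp
    rw [a2, Complex.ofReal_re] at h
    rw [← h]
    exact integral_congr_ae (Filter.Eventually.of_forall fun x => (a1 x).symm)
  simp only [e]
  refine ⟨i1.sub i2, ?_⟩
  rw [integral_sub i1 i2, h3, integral_gaussian]
  ring

lemma stepC {β : ℝ} (hβ0 : 0 < β) (hβ1 : β < 1) :
    Integrable (fun t : ℝ => (1 - cos t) * |t| ^ (β - 3)) ∧
    (√π * 2 ^ ((1:ℝ) - β) * Gamma ((1 - β) / 2) / Gamma (β / 2)) *
      ∫ t : ℝ, (1 - cos t) * |t| ^ (β - 3) = 2 * π / ((2 - β) * (1 - β)) := by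
  have hs : 0 < (3 - β) / 2 := by linarith
  have hG : 0 < Gamma ((3 - β) / 2) := Gamma_pos_of_pos hs
  have eB : ∀ u ∈ Set.Ioi (0:ℝ),
      (∫ t : ℝ, (1 - cos t) * (u ^ ((3 - β) / 2 - 1) * rexp (-(t ^ 2 * u))))
        = √π * (u ^ (-(β / 2)) * (1 - rexp (-((1/4) * u⁻¹)))) := by
    intro u hu
    have hu : 0 < u := hu
    have : ∀ t : ℝ, (1 - cos t) * (u ^ ((3 - β) / 2 - 1) * rexp (-(t ^ 2 * u)))
        = u ^ ((3 - β) / 2 - 1) * ((1 - cos t) * rexp (-(t ^ 2 * u))) := fun t => by ring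
    simp only [this]
    rw [integral_const_mul, (gauss hu).2, sqrt_div pi_pos.le, sqrt_eq_rpow u,
      show (3 - β) / 2 - 1 = -(β/2) + 1/2 by ring, rpow_add hu]
    have : u ^ (1/2:ℝ) ≠ 0 := by positivity
    field_simp
  obtain ⟨b1, b2⟩ := stepB (p := β / 2) (r := 1/4) (by linarith) (by linarith) (by norm_num)
  have key := tonelli_aux (μ := volume) (ν := volume.restrict (Set.Ioi (0:ℝ)))
    (fun t u => (1 - cos t) * (u ^ ((3 - β) / 2 - 1) * rexp (-(t ^ 2 * u))))
    (by unfold Function.uncurry; fun_prop) ?_ ?_ ?_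
  · have eA : ∀ᵐ t : ℝ, (∫ u in Set.Ioi (0:ℝ),
        (1 - cos t) * (u ^ ((3 - β) / 2 - 1) * rexp (-(t ^ 2 * u))))
        = Gamma ((3 - β) / 2) * ((1 - cos t) * |t| ^ (β - 3)) := by
      filter_upwards [compl_mem_ae_iff.mpr (measure_singleton (0:ℝ))] with t ht
      have ht : t ≠ 0 := ht
      have h2 : 0 < t ^ 2 := by positivity
      have h3 : 0 < |t| := abs_pos.mpr ht
      rw [integral_const_mul, integral_rpow_mul_exp_neg_mul_Ioi hs h2, one_div, inv_rpow h2.le,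
        ← rpow_neg h2.le, ← sq_abs, ← rpow_natCast, ← rpow_mul h3.le]
      rw [show ((2:ℕ):ℝ) * -((3 - β) / 2) = β - 3 by push_cast; ring]
      ring
    obtain ⟨k1, k2⟩ := key
    have k1' := (k1.congr eA).const_mul (Gamma ((3 - β) / 2))⁻¹
    simp only [inv_mul_cancel_left₀ hG.ne'] at k1'
    refine ⟨k1', ?_⟩
    rw [integral_congr_ae eA, setIntegral_congr_fun measurableSet_Ioi eB, integral_const_mul,
      integral_const_mul, b2] at k2
    have g1 : Gamma ((3 - β) / 2) = (1 - β) / 2 * Gamma ((1 - β) / 2) := by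
      rw [← Gamma_add_one (by linarith)]; congr 1; ring
    have q : ((1:ℝ)/4) ^ (1 - β / 2) = 2 ^ (β - 2) := by
      rw [show (1:ℝ)/4 = 2 ^ (-2:ℝ) by rw [rpow_neg (by norm_num)]; norm_num,
        ← rpow_mul (by norm_num)]
      ring_nf
    have q2 : (2:ℝ) ^ (1 - β) * 2 ^ (β - 2) = 1 / 2 := by
      rw [← rpow_add (by norm_num), show 1 - β + (β - 2) = -1 by ring, rpow_neg_one]; norm_num
    rw [g1, q] at k2
    set J := ∫ t : ℝ, (1 - cos t) * |t| ^ (β - 3)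
    have hG1 : 0 < Gamma ((1 - β) / 2) := Gamma_pos_of_pos (by linarith)
    have hG2 : 0 < Gamma (β / 2) := Gamma_pos_of_pos (by linarith)
    have hb1 : 0 < 1 - β := by linarith
    have hb2 : 0 < 2 - β := by linarith
    have hb3 : 0 < 1 - β / 2 := by linarith
    have k3 : Gamma ((1 - β) / 2) * J
        = 2 / (1 - β) * (√π * (2 ^ (β - 2) / (1 - β / 2) * Gamma (β / 2))) := by
      rw [← k2]; field_simp
    have hpi : √π * √π = π := mul_self_sqrt pi_pos.le
    calc √π * 2 ^ ((1:ℝ) - β) * Gamma ((1 - β) / 2) / Gamma (β / 2) * J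
        = √π * 2 ^ ((1:ℝ) - β) * (Gamma ((1 - β) / 2) * J) / Gamma (β / 2) := by ring
      _ = (√π * √π) * (2 ^ ((1:ℝ) - β) * 2 ^ (β - 2)) * 2 / ((1 - β) * (1 - β / 2)) := by
          rw [k3]; field_simp
      _ = 2 * π / ((2 - β) * (1 - β)) := by
          rw [hpi, q2]; field_simp
  · filter_upwards [ae_restrict_mem measurableSet_Ioi] with u hu
    have hu : 0 < u := hu
    refine Filter.Eventually.of_forall fun t => ?_
    have := cos_le_one t
    exact mul_nonneg (by linarith) (by positivity)
  · filter_upwards [ae_restrict_mem measurableSet_Ioi] with u hu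
    refine ((gauss hu).1.const_mul (u ^ ((3 - β) / 2 - 1))).congr ?_
    exact Filter.Eventually.of_forall fun t => by simp only; ring
  · exact IntegrableOn.congr_fun (b1.const_mul _) (fun u hu => (eB u hu).symm) measurableSet_Ioi

lemma stepD {β : ℝ} (hβ0 : 0 < β) (hβ1 : β < 1) (x : ℝ) :
    Integrable (fun t : ℝ => (1 - cos (x * t)) * |t| ^ (β - 3)) ∧
    ∫ t : ℝ, (1 - cos (x * t)) * |t| ^ (β - 3)
      = |x| ^ (2 - β) * ∫ t : ℝ, (1 - cos t) * |t| ^ (β - 3) := by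
  rcases eq_or_ne x 0 with rfl | hx
  · simp [zero_rpow (show 2 - β ≠ 0 by linarith)]
  have hx' : 0 < |x| := abs_pos.mpr hx
  have e : ∀ t : ℝ, (1 - cos (x * t)) * |t| ^ (β - 3)
      = |x| ^ (3 - β) * ((1 - cos (x * t)) * |x * t| ^ (β - 3)) := by
    intro t
    rw [abs_mul, mul_rpow hx'.le (abs_nonneg t)]
    have : |x| ^ (3 - β) * |x| ^ (β - 3) = 1 := by
      rw [← rpow_add hx']; simp
    linear_combination (- ((1 - cos (x * t)) * |t| ^ (β - 3))) * this
  simp only [e]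
  refine ⟨((stepC hβ0 hβ1).1.comp_mul_left' hx).const_mul _, ?_⟩
  rw [integral_const_mul,
    Measure.integral_comp_mul_left (fun t => (1 - cos t) * |t| ^ (β - 3)), smul_eq_mul,
    ← mul_assoc, abs_inv, ← div_eq_mul_inv, ← rpow_sub_one hx'.ne']
  ring_nf

lemma re_formula (a b c d ξ : ℝ) (hξ : ξ ≠ 0) :
    (fourierInd a b ξ * (starRingEnd ℂ) (fourierInd c d ξ)).re
      = ((1 - cos ((c - b) * ξ)) + (1 - cos ((d - a) * ξ)) - (1 - cos ((c - a) * ξ))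
        - (1 - cos ((d - b) * ξ))) * (ξ ^ 2)⁻¹ := by
  have h : fourierInd a b ξ * (starRingEnd ℂ) (fourierInd c d ξ)
      = (Complex.exp (((c - a) * ξ : ℝ) * Complex.I) - Complex.exp (((d - a) * ξ : ℝ) * Complex.I)
        - Complex.exp (((c - b) * ξ : ℝ) * Complex.I)
        + Complex.exp (((d - b) * ξ : ℝ) * Complex.I)) * (((ξ ^ 2)⁻¹ : ℝ) : ℂ) := by
    have hξ' : (ξ:ℂ) ≠ 0 := by exact_mod_cast hξ
    have ee : ∀ x y : ℝ, Complex.exp (((y - x) * ξ : ℝ) * Complex.I)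
        = Complex.exp (-Complex.I * ξ * x) * Complex.exp (Complex.I * ξ * y) := by
      intro x y
      rw [← Complex.exp_add]; congr 1; push_cast; ring
    unfold fourierInd
    simp only [map_div₀, map_sub, ← Complex.exp_conj, map_mul, map_neg, Complex.conj_I,
      Complex.conj_ofReal, neg_neg, ee]
    push_cast
    field_simp
    simp only [Complex.I_sq]
    ring
  rw [h, Complex.re_mul_ofReal]
  simp only [Complex.add_re, Complex.sub_re, Complex.exp_ofReal_mul_I_re]
  ring

theorem stmt3 (β a b c d : ℝ) (hβ0 : 0 < β) (hβ1 : β < 1) (hab : a < b) (hcd : c < d) :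
    (Real.sqrt Real.pi * 2 ^ ((1:ℝ) - β) * Real.Gamma ((1 - β) / 2) / Real.Gamma (β / 2)) *
      (∫ ξ : ℝ, (fourierInd a b ξ * (starRingEnd ℂ) (fourierInd c d ξ)).re * |ξ| ^ (β - 1))
      = (2 * Real.pi / ((2 - β) * (1 - β))) *
        (|c - b| ^ ((2:ℝ) - β) + |d - a| ^ ((2:ℝ) - β)
          - |c - a| ^ ((2:ℝ) - β) - |d - b| ^ ((2:ℝ) - β)) := by
  obtain ⟨_, hC⟩ := stepC hβ0 hβ1
  obtain ⟨i1, j1⟩ := stepD hβ0 hβ1 (c - b)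
  obtain ⟨i2, j2⟩ := stepD hβ0 hβ1 (d - a)
  obtain ⟨i3, j3⟩ := stepD hβ0 hβ1 (c - a)
  obtain ⟨i4, j4⟩ := stepD hβ0 hβ1 (d - b)
  have e : ∀ᵐ ξ : ℝ,
      (fourierInd a b ξ * (starRingEnd ℂ) (fourierInd c d ξ)).re * |ξ| ^ (β - 1)
      = (1 - cos ((c - b) * ξ)) * |ξ| ^ (β - 3) + (1 - cos ((d - a) * ξ)) * |ξ| ^ (β - 3)
        - (1 - cos ((c - a) * ξ)) * |ξ| ^ (β - 3) - (1 - cos ((d - b) * ξ)) * |ξ| ^ (β - 3) := by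
    filter_upwards [compl_mem_ae_iff.mpr (measure_singleton (0:ℝ))] with ξ hξ
    have hξ : ξ ≠ 0 := hξ
    have h3 : 0 < |ξ| := abs_pos.mpr hξ
    have : |ξ| ^ (β - 3) = (ξ ^ 2)⁻¹ * |ξ| ^ (β - 1) := by
      rw [show β - 3 = (β - 1) - (2:ℕ) by push_cast; ring, rpow_sub_natCast h3.ne', sq_abs]
      ring
    rw [re_formula a b c d ξ hξ, this]
    ring
  rw [integral_congr_ae e, integral_sub, integral_sub, integral_add i1 i2, j1, j2, j3, j4, ← hC]
  · ring
  · exact i1.add i2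
  · exact i3
  · exact (i1.add i2).sub i3
  · exact i4
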